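/- Let P ⊂ ℝ^n be an n-dimensional smooth lattice polytope with cd(P) ≥ (n+3)/2 (equivalently, n > 2·deg(P)). Then P is affinely isomorphic (by an affine-linear bijection mapping ℤ^{deg(P)+k} lattice points to lattice points) to a Cayley polytope P_0 * ⋯ * P_k of lattice polytopes P_0, …, P_k ⊆ ℝ^m with m = deg(P) and k = cd(P) − 1; in particular m ≤ 2·deg(P) and k > n/2. -/

import Mathlib

open scoped Pointwise
open MeasureTheory

noncomputable section

/-- The image of an integer point under the coercion `ℤ → ℝ` (a lattice point). -/
def latt {ι : Type*} (x : ι → ℤ) : ι → ℝ := fun i => (x i : ℝ)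

/-- A lattice polytope: the convex hull of finitely many points of `ℤ^ι`. -/
def IsLatticePolytope {ι : Type*} (P : Set (ι → ℝ)) : Prop :=
  ∃ V : Finset (ι → ℤ), P = convexHull ℝ (latt '' (V : Set (ι → ℤ)))

/-- The codegree: the smallest positive integer `k` such that the (relative) interior
of the dilate `kP` contains a lattice point. -/
def cd {ι : Type*} (P : Set (ι → ℝ)) : ℕ :=
  sInf {k : ℕ | 1 ≤ k ∧ ∃ x : ι → ℤ, latt x ∈ intrinsicInterior ℝ ((k : ℝ) • P)}

/-- `F` is a (nonempty, exposed) face of `P` of dimension `j`. -/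
def IsFaceOfDim {n : ℕ} (P F : Set (Fin n → ℝ)) (j : ℕ) : Prop :=
  F.Nonempty ∧ IsExposed ℝ P F ∧ Module.finrank ℝ (affineSpan ℝ F).direction = j

/-- `u` is an inner normal of the face `F` of `P`: `F` is exactly the set of points of `P`
minimizing the linear functional `⟨u, ·⟩` on `P`. -/
def IsInnerNormal {n : ℕ} (P F : Set (Fin n → ℝ)) (u : Fin n → ℤ) : Prop :=
  F = {x ∈ P | ∀ y ∈ P, ∑ i, (u i : ℝ) * x i ≤ ∑ i, (u i : ℝ) * y i}

/-- An `n`-dimensional lattice polytope is smooth if at every vertex exactly `n` facets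
meet, and the primitive integer inner normals of these facets form a `ℤ`-basis of `ℤ^n`
(equivalently, the matrix of these normals has determinant `±1`). -/
def IsSmoothPolytope {n : ℕ} (P : Set (Fin n → ℝ)) : Prop :=
  ∀ F0, IsFaceOfDim P F0 0 →
    ∃ (G : Fin n → Set (Fin n → ℝ)) (u : Fin n → Fin n → ℤ),
      Function.Injective G ∧
      (∀ i, IsFaceOfDim P (G i) (n - 1) ∧ F0 ⊆ G i ∧
        IsInnerNormal P (G i) (u i) ∧ Finset.univ.gcd (u i) = 1) ∧
      (∀ F, IsFaceOfDim P F (n - 1) → F0 ⊆ F → ∃ i, F = G i) ∧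
      IsUnit (Matrix.det (Matrix.of u))

/-- The `i`-th piece of a Cayley polytope: a point `p ∈ P_i ⊂ ℝ^m` is placed at height
`e_i` in `ℝ^m × ℝ^k`. -/
def cayleyVertex {m k : ℕ} (i : Fin k) (p : Fin m → ℝ) : Fin (m + k) → ℝ :=
  Fin.append p (fun t => if t = i then 1 else 0)

/-- The Cayley polytope `P_0 * ⋯ * P_{k-1} = conv(P_0 × e_0, …, P_{k-1} × e_{k-1})`. -/
def CayleyPolytope {m k : ℕ} (Ps : Fin k → Set (Fin m → ℝ)) : Set (Fin (m + k) → ℝ) :=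
  convexHull ℝ (⋃ i, cayleyVertex i '' Ps i)

/-- `T` realizes an affine-linear isomorphism of `Q ⊂ ℝ^N` (inside its affine hull) onto
`P ⊂ ℝ^n` (with an `n`-dimensional affine hull), mapping lattice points of `aff Q`
bijectively onto lattice points. -/
def LatticeEquivOnto {N n : ℕ} (Q : Set (Fin N → ℝ)) (P : Set (Fin n → ℝ))
    (T : (Fin N → ℝ) →ᵃ[ℝ] (Fin n → ℝ)) : Prop :=
  T '' Q = P ∧ Set.InjOn T (affineSpan ℝ Q : Set (Fin N → ℝ)) ∧
    T '' (affineSpan ℝ Q : Set (Fin N → ℝ)) = Set.univ ∧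
    ∀ x ∈ (affineSpan ℝ Q : Set (Fin N → ℝ)),
      ((∃ z : Fin N → ℤ, x = latt z) ↔ ∃ w : Fin n → ℤ, T x = latt w)


theorem exists_more_tight {E : Type*} [AddCommGroup E] [Module ℝ E] [FiniteDimensional ℝ E]
    (S : Finset E) (x y : E)
    (hspan : ∀ g : Module.Dual ℝ E, (∀ s ∈ S, g (s - x) = 0) → g = 0)
    (w : Module.Dual ℝ E) (hw : ∀ s ∈ S, 0 ≤ w (s - x)) (hy : w y < 0)
    (hrank : Module.finrank ℝ (Submodule.span ℝ ((fun s => s - x) '' {s | s ∈ S ∧ w (s - x) = 0})) + 1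
      ≠ Module.finrank ℝ E) :
    ∃ w' : Module.Dual ℝ E, (∀ s ∈ S, 0 ≤ w' (s - x)) ∧ w' y < 0 ∧
      S.filter (fun s => w (s - x) = 0) ⊂ S.filter (fun s => w' (s - x) = 0) := by
  set D := Submodule.span ℝ ((fun s => s - x) '' {s | s ∈ S ∧ w (s - x) = 0}) with hD
  have hw0 : w ≠ 0 := by rintro rfl; simp at hy
  have hDk : D ≤ LinearMap.ker w := by
    rw [hD, Submodule.span_le]
    rintro _ ⟨s, hs, rfl⟩
    exact hs.2
  have h1 := Module.Dual.finrank_ker_add_one_of_ne_zero hw0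
  have h2 := Submodule.finrank_mono hDk
  have h3 : D ⊔ Submodule.span ℝ {y} < ⊤ := by
    rw [lt_top_iff_ne_top]
    intro htop
    have h4 := Submodule.finrank_add_le_finrank_add_finrank D (Submodule.span ℝ {y})
    rw [htop, finrank_top] at h4
    have h5 := finrank_span_le_card (R := ℝ) ({y} : Set E)
    simp at h5
    omega
  obtain ⟨g, hg0, hg⟩ := Submodule.exists_le_ker_of_lt_top _ h3
  have hgD : ∀ s ∈ S, w (s - x) = 0 → g (s - x) = 0 := fun s hs h =>
    hg (Submodule.mem_sup_left (Submodule.subset_span ⟨s, ⟨hs, h⟩, rfl⟩))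
  have hgy : g y = 0 := hg (Submodule.mem_sup_right (Submodule.mem_span_singleton_self y))
  obtain ⟨g', hgD', hgy', s₁, hs₁, hneg⟩ : ∃ g' : Module.Dual ℝ E,
      (∀ s ∈ S, w (s - x) = 0 → g' (s - x) = 0) ∧ g' y = 0 ∧ ∃ s ∈ S, g' (s - x) < 0 := by
    by_contra! hcon
    apply hg0
    apply hspan
    intro s hs
    have a := hcon g hgD hgy s hs
    have b := hcon (-g) (fun s hs h => by simp only [LinearMap.neg_apply, hgD s hs h, neg_zero])
      (by simp [hgy]) s hs
    rw [LinearMap.neg_apply] at b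
    linarith
  obtain ⟨s₀, hs₀, hmin⟩ := Finset.exists_min_image (S.filter (fun s => g' (s - x) < 0))
    (fun s => w (s - x) / (-g' (s - x))) ⟨s₁, Finset.mem_filter.mpr ⟨hs₁, hneg⟩⟩
  rw [Finset.mem_filter] at hs₀
  set c := w (s₀ - x) / (-g' (s₀ - x)) with hc
  have hc0 : 0 ≤ c := div_nonneg (hw _ hs₀.1) (by linarith [hs₀.2])
  refine ⟨w + c • g', ?_, ?_, ?_⟩
  · intro s hs
    simp only [LinearMap.add_apply, LinearMap.smul_apply, smul_eq_mul]
    rcases lt_or_ge (g' (s - x)) 0 with h | h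
    · have := hmin s (Finset.mem_filter.mpr ⟨hs, h⟩)
      rw [le_div_iff₀ (by linarith)] at this
      linarith
    · have := hw s hs
      positivity
  · simp [hgy', hy]
  · rw [Finset.ssubset_iff_of_subset]
    · refine ⟨s₀, ?_, ?_⟩
      · have h : -g' (s₀ - x) ≠ 0 := by linarith [hs₀.2]
        simp only [Finset.mem_filter, LinearMap.add_apply, LinearMap.smul_apply, smul_eq_mul]
        refine ⟨hs₀.1, ?_⟩
        have : c * (-g' (s₀ - x)) = w (s₀ - x) := div_mul_cancel₀ _ h
        linarith
      · simp only [Finset.mem_filter, not_and]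
        intro _ h
        have := hgD' _ hs₀.1 h
        linarith [hs₀.2]
    · intro s hs
      rw [Finset.mem_filter] at hs ⊢
      refine ⟨hs.1, ?_⟩
      simp [hs.2, hgD' s hs.1 hs.2, -map_sub]

/-- A functional that is nonnegative on the cone spanned by `S - x` and negative at `y` can be
replaced by one that moreover vanishes on a set of generators spanning a hyperplane. -/
theorem exists_facet_functional {E : Type*} [AddCommGroup E] [Module ℝ E] [FiniteDimensional ℝ E]
    (S : Finset E) (x y : E)
    (hspan : ∀ g : Module.Dual ℝ E, (∀ s ∈ S, g (s - x) = 0) → g = 0)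
    (w : Module.Dual ℝ E) (hw : ∀ s ∈ S, 0 ≤ w (s - x)) (hy : w y < 0) :
    ∃ w' : Module.Dual ℝ E, (∀ s ∈ S, 0 ≤ w' (s - x)) ∧ w' y < 0 ∧
      Module.finrank ℝ (Submodule.span ℝ ((fun s => s - x) '' {s | s ∈ S ∧ w' (s - x) = 0})) + 1
        = Module.finrank ℝ E := by
  induction h : S.card - (S.filter (fun s => w (s - x) = 0)).card using Nat.strong_induction_on
    generalizing w with
  | _ k ih =>
    by_cases hrank : Module.finrank ℝ
        (Submodule.span ℝ ((fun s => s - x) '' {s | s ∈ S ∧ w (s - x) = 0})) + 1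
        = Module.finrank ℝ E
    · exact ⟨w, hw, hy, hrank⟩
    · obtain ⟨w', h1, h2, h3⟩ := exists_more_tight S x y hspan w hw hy hrank
      have h4 := Finset.card_lt_card h3
      have h5 := Finset.card_filter_le S (fun s => w' (s - x) = 0)
      exact ih _ (by omega) w' h1 h2 rfl

theorem latt_add {ι : Type*} (x y : ι → ℤ) : latt (x + y) = latt x + latt y := by
  ext i; simp [latt]

theorem latt_sub {ι : Type*} (x y : ι → ℤ) : latt (x - y) = latt x - latt y := by
  ext i; simp [latt]

theorem latt_smul {ι : Type*} (c : ℤ) (x : ι → ℤ) : latt (c • x) = (c : ℝ) • latt x := by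
  ext i; simp [latt]

theorem latt_sum {ι κ : Type*} (s : Finset κ) (x : κ → ι → ℤ) :
    latt (∑ k ∈ s, x k) = ∑ k ∈ s, latt (x k) := by
  ext i; simp [latt, Finset.sum_apply]

theorem latt_injective {ι : Type*} : Function.Injective (latt (ι := ι)) := by
  intro x y h
  ext i
  exact Int.cast_injective (α := ℝ) (congrFun h i)

/-- The linear functional on `ℝ^n` given by an integer vector. -/
def pair {n : ℕ} (u : Fin n → ℤ) : Module.Dual ℝ (Fin n → ℝ) :=
  ∑ i, (u i : ℝ) • LinearMap.proj i

theorem pair_apply {n : ℕ} (u : Fin n → ℤ) (x : Fin n → ℝ) :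
    pair u x = ∑ i, (u i : ℝ) * x i := by
  simp [pair]

theorem pair_latt {n : ℕ} (u x : Fin n → ℤ) : pair u (latt x) = ((u ⬝ᵥ x : ℤ) : ℝ) := by
  simp [pair_apply, latt, dotProduct]

/-- `u` and `f` are dual `ℤ`-bases. -/
def IsDualPair {n : ℕ} (u f : Fin n → Fin n → ℤ) : Prop :=
  ∀ l k, u l ⬝ᵥ f k = if l = k then 1 else 0

theorem IsDualPair.sum_mul {n : ℕ} {u f : Fin n → Fin n → ℤ} (h : IsDualPair u f) (i k : Fin n) :
    ∑ l, f l i * u l k = if i = k then 1 else 0 := by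
  have h1 : Matrix.of u * (Matrix.of f).transpose = 1 := by
    ext l k
    simp only [Matrix.mul_apply, Matrix.of_apply, Matrix.transpose_apply, Matrix.one_apply]
    exact h l k
  have h2 := mul_eq_one_comm.mp h1
  replace h2 := congrFun (congrFun h2 i) k
  simpa [Matrix.mul_apply, Matrix.one_apply] using h2

theorem IsDualPair.decomp {n : ℕ} {u f : Fin n → Fin n → ℤ} (h : IsDualPair u f)
    (z : Fin n → ℝ) : ∑ l, pair (u l) z • latt (f l) = z := by
  ext i
  simp only [Finset.sum_apply, Pi.smul_apply, smul_eq_mul, pair_apply, latt, Finset.sum_mul]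
  rw [Finset.sum_comm]
  have : ∀ k, ∑ l, (u l k : ℝ) * z k * (f l i : ℝ) = (if i = k then 1 else 0) * z k := by
    intro k
    have := congrArg (Int.cast : ℤ → ℝ) (h.sum_mul i k)
    push_cast at this
    rw [← this, Finset.sum_mul]
    exact Finset.sum_congr rfl fun l _ => by ring
  simp [this]

theorem IsDualPair.decomp_int {n : ℕ} {u f : Fin n → Fin n → ℤ} (h : IsDualPair u f)
    (z : Fin n → ℤ) : ∑ l, (u l ⬝ᵥ z) • f l = z := by
  apply latt_injective
  rw [latt_sum]
  simp only [latt_smul, ← pair_latt]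
  exact h.decomp _

theorem IsDualPair.pair_latt_apply {n : ℕ} {u f : Fin n → Fin n → ℤ} (h : IsDualPair u f)
    (l k : Fin n) : pair (u l) (latt (f k)) = if l = k then 1 else 0 := by
  rw [pair_latt, h l k]; split_ifs <;> simp

theorem exists_isDualPair {n : ℕ} (u : Fin n → Fin n → ℤ) (h : IsUnit (Matrix.det (Matrix.of u))) :
    ∃ f, IsDualPair u f := by
  refine ⟨fun k i => (Matrix.of u)⁻¹ i k, fun l k => ?_⟩
  have := congrFun (congrFun (Matrix.mul_nonsing_inv (Matrix.of u) h) l) k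
  simpa [Matrix.mul_apply, Matrix.one_apply, dotProduct] using this

/-- Replacing the `j`-th vector of a basis by `p` with `⟨p, f_j⟩ = -1`. -/
theorem IsDualPair.update {n : ℕ} {u f : Fin n → Fin n → ℤ} (h : IsDualPair u f) (j : Fin n)
    (p : Fin n → ℤ) (hp : p ⬝ᵥ f j = -1) :
    IsDualPair (Function.update u j p)
      (fun l => if l = j then -f j else f l + (p ⬝ᵥ f l) • f j) := by
  intro a b
  by_cases ha : a = j
  · subst ha
    by_cases hb : b = a
    · subst hb; simp [hp]
    · beta_reduce
      rw [Function.update_self, if_neg hb, if_neg (Ne.symm hb), dotProduct_add, dotProduct_smul, hp]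
      simp
  · by_cases hb : b = j
    · subst hb; simp [ha, h a b]
    · beta_reduce
      rw [Function.update_of_ne ha, if_neg hb, dotProduct_add, dotProduct_smul, h a b, h a j]
      simp [ha]

theorem convexHull_ge {n : ℕ} {S : Finset (Fin n → ℤ)} {g : Module.Dual ℝ (Fin n → ℝ)} {a : ℝ}
    (h : ∀ s ∈ S, a ≤ g (latt s)) :
    ∀ z ∈ convexHull ℝ (latt '' (S : Set (Fin n → ℤ))), a ≤ g z := by
  have : convexHull ℝ (latt '' (S : Set (Fin n → ℤ))) ⊆ {z | a ≤ g z} := by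
    apply convexHull_min
    · rintro _ ⟨s, hs, rfl⟩
      exact h s hs
    · exact convex_halfSpace_ge g.isLinear a
  exact this

theorem latt_mem_convexHull {n : ℕ} {S : Finset (Fin n → ℤ)} {s : Fin n → ℤ} (hs : s ∈ S) :
    latt s ∈ convexHull ℝ (latt '' (S : Set (Fin n → ℤ))) :=
  subset_convexHull ℝ _ ⟨s, hs, rfl⟩

theorem isExposed_min {n : ℕ} (P : Set (Fin n → ℝ)) (g : Module.Dual ℝ (Fin n → ℝ))
    {a : ℝ} (ha : ∀ z ∈ P, a ≤ g z) (hne : ∃ z ∈ P, g z = a) :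
    IsExposed ℝ P {z ∈ P | g z = a} := by
  intro _
  obtain ⟨z₀, hz₀, h₀⟩ := hne
  refine ⟨-(LinearMap.toContinuousLinearMap g), ?_⟩
  ext z
  simp only [Set.mem_ofPred_eq, neg_apply, neg_le_neg_iff,
    LinearMap.coe_toContinuousLinearMap']
  constructor
  · rintro ⟨hz, h⟩
    exact ⟨hz, fun y hy => h ▸ ha y hy⟩
  · rintro ⟨hz, h⟩
    exact ⟨hz, le_antisymm (h₀ ▸ h z₀ hz₀) (ha z hz)⟩

theorem isFaceOfDim_zero_of_strict_min {n : ℕ} {S : Finset (Fin n → ℤ)} {x : Fin n → ℤ}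
    (hx : x ∈ S) (g : Module.Dual ℝ (Fin n → ℝ))
    (h : ∀ s ∈ S, s ≠ x → g (latt x) < g (latt s)) :
    IsFaceOfDim (convexHull ℝ (latt '' (S : Set (Fin n → ℤ)))) {latt x} 0 := by
  have hsub : convexHull ℝ (latt '' (S : Set (Fin n → ℤ))) ⊆
      {z | g (latt x) < g z ∨ z = latt x} := by
    apply convexHull_min
    · rintro _ ⟨s, hs, rfl⟩
      by_cases hsx : s = x
      · exact Or.inr (by rw [hsx])
      · exact Or.inl (h s hs hsx)
    · intro y hy z hz a b ha hb hab
      simp only [Set.mem_ofPred_eq, map_add, map_smul, smul_eq_mul] at hy hz ⊢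
      have hb' : b = 1 - a := by linarith
      subst hb'
      rcases hy with hy | rfl
      · rcases ha.eq_or_lt with rfl | ha'
        · simpa using hz
        · left
          rcases hz with hz | rfl <;> nlinarith
      · rcases hz with hz | rfl
        · rcases hb.eq_or_lt with hb' | hb'
          · right
            rw [← hb', show a = 1 by linarith]; simp
          · left; nlinarith
        · right
          rw [← add_smul]; simp
  have heq : ({latt x} : Set (Fin n → ℝ)) =
      {z ∈ convexHull ℝ (latt '' (S : Set (Fin n → ℤ))) | g z = g (latt x)} := by
    ext z
    constructor
    · rintro rfl
      exact ⟨latt_mem_convexHull hx, rfl⟩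
    · rintro ⟨hz, h⟩
      rcases hsub hz with h' | h'
      · exact absurd h h'.ne'
      · exact h'
  refine ⟨Set.singleton_nonempty _, ?_, ?_⟩
  · rw [heq]
    apply isExposed_min
    · intro z hz
      rcases hsub hz with h' | h'
      · exact h'.le
      · rw [h']
    · exact ⟨_, latt_mem_convexHull hx, rfl⟩
  · rw [direction_affineSpan]; simp

/-- A nonempty lattice polytope has a vertex: a generator of maximal Euclidean norm. -/
theorem exists_vertex {n : ℕ} {S : Finset (Fin n → ℤ)} (hS : S.Nonempty) :
    ∃ x ∈ S, IsFaceOfDim (convexHull ℝ (latt '' (S : Set (Fin n → ℤ)))) {latt x} 0 := by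
  obtain ⟨x, hx, hmax⟩ := S.exists_max_image (fun s => s ⬝ᵥ s) hS
  refine ⟨x, hx, isFaceOfDim_zero_of_strict_min hx (pair (-x)) ?_⟩
  intro s hs hsx
  rw [pair_latt, pair_latt, Int.cast_lt, neg_dotProduct, neg_dotProduct, neg_lt_neg_iff]
  have h1 : 0 < (s - x) ⬝ᵥ (s - x) := by
    refine lt_of_le_of_ne (Finset.sum_nonneg fun i _ => mul_self_nonneg _) ?_
    intro h
    exact hsx (sub_eq_zero.mp (dotProduct_self_eq_zero.mp h.symm))
  rw [sub_dotProduct, dotProduct_sub, dotProduct_sub, dotProduct_comm s x] at h1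
  have h2 := hmax s hs
  linarith

theorem dual_eq_zero_of_affineSpan {n : ℕ} {S : Finset (Fin n → ℤ)}
    (hfull : affineSpan ℝ (convexHull ℝ (latt '' (S : Set (Fin n → ℤ)))) = ⊤)
    (x : Fin n → ℝ) (g : Module.Dual ℝ (Fin n → ℝ)) (hg : ∀ s ∈ S, g (latt s - x) = 0) :
    g = 0 := by
  rw [affineSpan_convexHull] at hfull
  have h := AffineSubspace.vectorSpan_eq_top_of_affineSpan_eq_top ℝ _ _ hfull
  have h2 : vectorSpan ℝ (latt '' (S : Set (Fin n → ℤ))) ≤ LinearMap.ker g := by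
    rw [vectorSpan_def, Submodule.span_le]
    rintro _ ⟨_, ⟨s, hs, rfl⟩, _, ⟨t, ht, rfl⟩, rfl⟩
    have a := hg s hs
    have b := hg t ht
    rw [map_sub] at a b
    simp only [vsub_eq_sub, SetLike.mem_coe, LinearMap.mem_ker, map_sub]
    linarith
  rw [h, top_le_iff] at h2
  exact LinearMap.ker_eq_top.mp h2

theorem isFaceOfDim_facet {n : ℕ} {S : Finset (Fin n → ℤ)} {x : Fin n → ℝ}
    (hx : x ∈ convexHull ℝ (latt '' (S : Set (Fin n → ℤ))))
    (w : Module.Dual ℝ (Fin n → ℝ)) (hw0 : w ≠ 0) (hw : ∀ s ∈ S, 0 ≤ w (latt s - x))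
    (hrank : Module.finrank ℝ (Submodule.span ℝ
      ((fun s => s - x) '' {s | s ∈ S.image latt ∧ w (s - x) = 0})) + 1
        = Module.finrank ℝ (Fin n → ℝ)) :
    IsFaceOfDim (convexHull ℝ (latt '' (S : Set (Fin n → ℤ))))
      {z ∈ convexHull ℝ (latt '' (S : Set (Fin n → ℤ))) | w z = w x} (n - 1) := by
  refine ⟨⟨x, hx, rfl⟩, isExposed_min _ w (convexHull_ge fun s hs => ?_) ⟨x, hx, rfl⟩, ?_⟩
  · have := hw s hs
    rw [map_sub] at this
    linarith
  · rw [direction_affineSpan]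
    have h1 := Module.Dual.finrank_ker_add_one_of_ne_zero hw0
    have h2 := Submodule.finrank_mono (R := ℝ) (M := Fin n → ℝ)
      (s := vectorSpan ℝ {z ∈ convexHull ℝ (latt '' (S : Set (Fin n → ℤ))) | w z = w x})
      (t := LinearMap.ker w) (by
        rw [vectorSpan_def, Submodule.span_le]
        rintro _ ⟨y, hy, z, hz, rfl⟩
        simp only [vsub_eq_sub, SetLike.mem_coe, LinearMap.mem_ker, map_sub, hy.2, hz.2, sub_self])
    have h3 := Submodule.finrank_mono (R := ℝ) (M := Fin n → ℝ)
      (t := vectorSpan ℝ {z ∈ convexHull ℝ (latt '' (S : Set (Fin n → ℤ))) | w z = w x})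
      (s := Submodule.span ℝ ((fun s => s - x) '' {s | s ∈ S.image latt ∧ w (s - x) = 0})) (by
        rw [Submodule.span_le]
        rintro _ ⟨s, ⟨hs', hs0⟩, rfl⟩
        obtain ⟨s, hs, rfl⟩ := Finset.mem_image.mp hs'
        refine vsub_mem_vectorSpan ℝ ⟨latt_mem_convexHull hs, ?_⟩ ⟨hx, rfl⟩
        rw [map_sub] at hs0
        linarith)
    simp only [Module.finrank_fin_fun] at *
    omega

/-- The endpoint of an edge: if the inequalities `u_l` account for all facets through the lattice
point `x`, then a positive multiple of each dual basis vector leads from `x` to a generator. -/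
theorem exists_edge_endpoint {n : ℕ} {S : Finset (Fin n → ℤ)}
    (hfull : affineSpan ℝ (convexHull ℝ (latt '' (S : Set (Fin n → ℤ)))) = ⊤)
    {x : Fin n → ℤ} (hx : latt x ∈ convexHull ℝ (latt '' (S : Set (Fin n → ℤ))))
    {u f : Fin n → Fin n → ℤ} (hd : IsDualPair u f)
    (hnn : ∀ l, ∀ s ∈ S, 0 ≤ u l ⬝ᵥ (s - x))
    (hfac : ∀ F, IsFaceOfDim (convexHull ℝ (latt '' (S : Set (Fin n → ℤ)))) F (n - 1) →
      latt x ∈ F → ∃ l, ∀ z ∈ F, pair (u l) z = pair (u l) (latt x)) (i : Fin n) :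
    ∃ k : ℤ, 1 ≤ k ∧ x + k • f i ∈ S := by
  by_contra! hcon
  have hpos : ∀ s ∈ S, s ≠ x → 1 ≤ ∑ l ∈ Finset.univ.erase i, u l ⬝ᵥ (s - x) := by
    intro s hs hsx
    by_contra! hlt
    have h0 : ∑ l ∈ Finset.univ.erase i, u l ⬝ᵥ (s - x) = 0 :=
      le_antisymm (by omega) (Finset.sum_nonneg fun l _ => hnn l s hs)
    rw [Finset.sum_eq_zero_iff_of_nonneg fun l _ => hnn l s hs] at h0
    have h1 := hd.decomp_int (s - x)
    rw [← Finset.add_sum_erase _ _ (Finset.mem_univ i),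
      Finset.sum_eq_zero (fun l hl => by rw [h0 l hl, zero_smul]), add_zero] at h1
    have h2 : u i ⬝ᵥ (s - x) ≠ 0 := by
      intro h
      rw [h, zero_smul] at h1
      exact hsx (sub_eq_zero.mp h1.symm)
    refine hcon (u i ⬝ᵥ (s - x)) (by have := hnn i s hs; omega) ?_
    rw [h1]
    simpa using hs
  set N : ℤ := ∑ s ∈ S, u i ⬝ᵥ (s - x) with hN
  set w₀ : Fin n → ℤ := N • ∑ l ∈ Finset.univ.erase i, u l - u i with hw₀
  have hT : ∀ g : Module.Dual ℝ (Fin n → ℝ), (∀ s ∈ S.image latt, g (s - latt x) = 0) → g = 0 :=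
    fun g hg => dual_eq_zero_of_affineSpan hfull (latt x) g fun s hs =>
      hg _ (Finset.mem_image_of_mem _ hs)
  obtain ⟨w, hw, hwy, hrank⟩ := exists_facet_functional (S.image latt) (latt x) (latt (f i)) hT
    (pair w₀) (by
      intro s hs'
      obtain ⟨s, hs, rfl⟩ := Finset.mem_image.mp hs'
      rw [← latt_sub, pair_latt, Int.cast_nonneg_iff]
      by_cases hsx : s = x
      · simp [hsx]
      · have h1 := hpos s hs hsx
        have h2 : u i ⬝ᵥ (s - x) ≤ N :=
          Finset.single_le_sum (f := fun s => u i ⬝ᵥ (s - x)) (fun s hs => hnn i s hs) hs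
        have h3 := hnn i s hs
        rw [hw₀, sub_dotProduct, smul_dotProduct, sum_dotProduct, smul_eq_mul]
        nlinarith) (by
      have : w₀ ⬝ᵥ f i = -1 := by
        rw [hw₀, sub_dotProduct, smul_dotProduct, sum_dotProduct, hd i i,
          Finset.sum_eq_zero (fun l hl => by rw [hd l i, if_neg (Finset.ne_of_mem_erase hl)])]
        simp
      rw [pair_latt, this]
      norm_num)
  have hw' : ∀ s ∈ S, 0 ≤ w (latt s - latt x) := fun s hs => hw _ (Finset.mem_image_of_mem _ hs)
  have hw0 : w ≠ 0 := by rintro rfl; simp at hwy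
  have hF := isFaceOfDim_facet hx w hw0 hw' hrank
  obtain ⟨l, hl⟩ := hfac _ hF ⟨hx, rfl⟩
  have hu0 : pair (u l) ≠ 0 := by
    intro h
    have := hd.pair_latt_apply l l
    rw [h] at this
    simp at this
  have hdim := hF.2.2
  rw [direction_affineSpan] at hdim
  set F := {z ∈ convexHull ℝ (latt '' (S : Set (Fin n → ℤ))) | w z = w (latt x)} with hFdef
  have hle : ∀ g : Module.Dual ℝ (Fin n → ℝ), g ≠ 0 → (∀ z ∈ F, g z = g (latt x)) →
      vectorSpan ℝ F = LinearMap.ker g := by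
    intro g hg0 hg
    apply Submodule.eq_of_le_of_finrank_eq
    · rw [vectorSpan_def, Submodule.span_le]
      rintro _ ⟨y, hy, z, hz, rfl⟩
      simp [hg y hy, hg z hz]
    · have := Module.Dual.finrank_ker_add_one_of_ne_zero hg0
      rw [hdim]
      simp only [Module.finrank_fin_fun] at this
      omega
  have hker : LinearMap.ker (pair (u l)) = LinearMap.ker w :=
    (hle _ hu0 hl).symm.trans (hle w hw0 fun z hz => hz.2)
  have hkey : ∀ v, pair (u l) v = 0 → w v = 0 := fun v hv => by
    have : v ∈ LinearMap.ker (pair (u l)) := hv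
    rwa [hker] at this
  by_cases hli : l = i
  · subst hli
    apply hw0
    apply hT
    intro s hs'
    refine le_antisymm ?_ (hw s hs')
    obtain ⟨s, hs, rfl⟩ := Finset.mem_image.mp hs'
    have h1 := hkey ((latt s - latt x) - pair (u l) (latt s - latt x) • latt (f l)) (by
      rw [map_sub, map_smul, hd.pair_latt_apply]; simp)
    rw [map_sub, map_smul, smul_eq_mul, sub_eq_zero] at h1
    rw [h1]
    refine mul_nonpos_of_nonneg_of_nonpos ?_ hwy.le
    rw [← latt_sub, pair_latt, Int.cast_nonneg_iff]
    exact hnn l s hs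
  · exact hwy.ne (hkey _ (by rw [hd.pair_latt_apply, if_neg hli]))

/-- The convex hull of a finite set of lattice points. -/
abbrev latticeHull {n : ℕ} (S : Finset (Fin n → ℤ)) : Set (Fin n → ℝ) :=
  convexHull ℝ (latt '' (S : Set (Fin n → ℤ)))

/-- The facets `G_l` are all the facets of `latticeHull S` through the lattice point `x`, and
their normals `u_l` form a `ℤ`-basis with dual basis `f_l`. -/
structure IsVertexChart {n : ℕ} (S : Finset (Fin n → ℤ)) (x : Fin n → ℤ)
    (G : Fin n → Set (Fin n → ℝ)) (u f : Fin n → Fin n → ℤ) : Prop where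
  mem : latt x ∈ latticeHull S
  dual : IsDualPair u f
  inj : Function.Injective G
  facet : ∀ l, IsFaceOfDim (latticeHull S) (G l) (n - 1)
  eq : ∀ l, G l = {z ∈ latticeHull S | pair (u l) z = pair (u l) (latt x)}
  ge : ∀ l, ∀ z ∈ latticeHull S, pair (u l) (latt x) ≤ pair (u l) z
  all : ∀ F, IsFaceOfDim (latticeHull S) F (n - 1) → latt x ∈ F → ∃ l, F = G l

theorem IsSmoothPolytope.exists_chart {n : ℕ} {S : Finset (Fin n → ℤ)}
    (hsmooth : IsSmoothPolytope (latticeHull S)) {x : Fin n → ℤ}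
    (hx : IsFaceOfDim (latticeHull S) {latt x} 0) : ∃ G u f, IsVertexChart S x G u f := by
  obtain ⟨G, u, hinj, hG, hall, hdet⟩ := hsmooth _ hx
  obtain ⟨f, hf⟩ := exists_isDualPair u hdet
  have hxG : ∀ l, latt x ∈ G l := fun l => (hG l).2.1 rfl
  have hnorm : ∀ l, G l = {z ∈ latticeHull S | ∀ y ∈ latticeHull S, pair (u l) z ≤ pair (u l) y} :=
    fun l => by
      simp only [pair_apply]
      exact (hG l).2.2.1
  have hmin : ∀ l, latt x ∈ latticeHull S ∧
      ∀ y ∈ latticeHull S, pair (u l) (latt x) ≤ pair (u l) y := fun l => by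
    have := hxG l
    rw [hnorm l] at this
    exact this
  refine ⟨G, u, f, ?_, hf, hinj, fun l => (hG l).1, fun l => ?_, fun l => (hmin l).2,
    fun F hF hxF => hall F hF (Set.singleton_subset_iff.mpr hxF)⟩
  · exact hx.2.1.subset rfl
  · rw [hnorm l]
    ext z
    constructor
    · rintro ⟨hz, h⟩
      exact ⟨hz, le_antisymm (h _ (hmin l).1) ((hmin l).2 z hz)⟩
    · rintro ⟨hz, h⟩
      exact ⟨hz, fun y hy => h.trans_le ((hmin l).2 y hy)⟩

theorem latt_add_smul_mem {n : ℕ} {P : Set (Fin n → ℝ)} (hP : Convex ℝ P) {x v : Fin n → ℤ}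
    (hx : latt x ∈ P) {k m : ℤ} (hk : latt (x + k • v) ∈ P) (hm : 0 ≤ m) (hmk : m ≤ k) :
    latt (x + m • v) ∈ P := by
  rcases hm.eq_or_lt with rfl | hm0
  · simpa using hx
  have hk0 : (0 : ℝ) < k := by exact_mod_cast hm0.trans_le hmk
  have hm' : (0 : ℝ) < m := by exact_mod_cast hm0
  have hmk' : (m : ℝ) ≤ k := by exact_mod_cast hmk
  have := hP.add_smul_sub_mem hx hk (t := (m : ℝ) / k)
    ⟨by positivity, by rw [div_le_one hk0]; exact hmk'⟩
  convert this using 1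
  rw [← latt_sub, add_sub_cancel_left, latt_add, latt_smul, latt_smul, smul_smul,
    div_mul_cancel₀ _ hk0.ne']

theorem IsVertexChart.int_nonneg {n : ℕ} {S : Finset (Fin n → ℤ)} {x : Fin n → ℤ}
    {G : Fin n → Set (Fin n → ℝ)} {u f : Fin n → Fin n → ℤ} (h : IsVertexChart S x G u f)
    (l : Fin n) {s : Fin n → ℤ} (hs : s ∈ S) : 0 ≤ u l ⬝ᵥ (s - x) := by
  have := h.ge l _ (latt_mem_convexHull hs)
  rw [pair_latt, pair_latt, Int.cast_le] at this
  rw [dotProduct_sub]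
  omega

theorem IsVertexChart.exists_edge {n : ℕ} {S : Finset (Fin n → ℤ)} {x : Fin n → ℤ}
    {G : Fin n → Set (Fin n → ℝ)} {u f : Fin n → Fin n → ℤ} (h : IsVertexChart S x G u f)
    (hfull : affineSpan ℝ (latticeHull S) = ⊤) (i : Fin n) :
    ∃ k : ℤ, 1 ≤ k ∧ x + k • f i ∈ S := by
  refine exists_edge_endpoint hfull h.mem h.dual (fun l s hs => h.int_nonneg l hs) ?_ i
  intro F hF hxF
  obtain ⟨l, rfl⟩ := h.all F hF hxF
  refine ⟨l, fun z hz => ?_⟩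
  rw [h.eq l] at hz
  exact hz.2

theorem IsVertexChart.eq_add_smul {n : ℕ} {S : Finset (Fin n → ℤ)} {x : Fin n → ℤ}
    {G : Fin n → Set (Fin n → ℝ)} {u f : Fin n → Fin n → ℤ} (h : IsVertexChart S x G u f)
    (i : Fin n) {s : Fin n → ℤ} (hs : s ∈ S)
    (h0 : ∑ l ∈ Finset.univ.erase i, u l ⬝ᵥ (s - x) = 0) : s = x + (u i ⬝ᵥ (s - x)) • f i := by
  rw [Finset.sum_eq_zero_iff_of_nonneg fun l _ => h.int_nonneg l hs] at h0
  have h1 := h.dual.decomp_int (s - x)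
  rw [← Finset.add_sum_erase _ _ (Finset.mem_univ i),
    Finset.sum_eq_zero (fun l hl => by rw [h0 l hl, zero_smul]), add_zero] at h1
  rw [h1, add_sub_cancel]

/-- If the edge from `x` in direction `f_i` has lattice length one, its other endpoint is a
vertex. -/
theorem IsVertexChart.isFaceOfDim_edge {n : ℕ} {S : Finset (Fin n → ℤ)} {x : Fin n → ℤ}
    {G : Fin n → Set (Fin n → ℝ)} {u f : Fin n → Fin n → ℤ} (h : IsVertexChart S x G u f)
    (hfull : affineSpan ℝ (latticeHull S) = ⊤) (i : Fin n)
    (h2 : latt (x + (2 : ℤ) • f i) ∉ latticeHull S) :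
    x + f i ∈ S ∧ IsFaceOfDim (latticeHull S) {latt (x + f i)} 0 := by
  have hle : ∀ k : ℤ, x + k • f i ∈ S → k ≤ 1 := by
    intro k hk
    by_contra! hk1
    exact h2 (latt_add_smul_mem (convex_convexHull ℝ _) h.mem (latt_mem_convexHull hk)
      (by norm_num) hk1)
  have hmem : x + f i ∈ S := by
    obtain ⟨k, hk, hkS⟩ := h.exists_edge hfull i
    rw [le_antisymm (hle k hkS) hk, one_smul] at hkS
    exact hkS
  refine ⟨hmem, isFaceOfDim_zero_of_strict_min hmem
    (pair ((∑ s ∈ S, u i ⬝ᵥ (s - x)) • ∑ l ∈ Finset.univ.erase i, u l - u i)) ?_⟩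
  intro s hs hsx
  rw [pair_latt, pair_latt, Int.cast_lt]
  set N : ℤ := ∑ s ∈ S, u i ⬝ᵥ (s - x)
  have hval : ∀ y : Fin n → ℤ, (N • ∑ l ∈ Finset.univ.erase i, u l - u i) ⬝ᵥ (y - x) =
      N * ∑ l ∈ Finset.univ.erase i, u l ⬝ᵥ (y - x) - u i ⬝ᵥ (y - x) := fun y => by
    rw [sub_dotProduct, smul_dotProduct, sum_dotProduct, smul_eq_mul]
  have h1 := hval s
  have h3 := hval (x + f i)
  have h4 : ∑ l ∈ Finset.univ.erase i, u l ⬝ᵥ (x + f i - x) = 0 :=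
    Finset.sum_eq_zero fun l hl => by
      rw [add_sub_cancel_left, h.dual l i, if_neg (Finset.ne_of_mem_erase hl)]
  rw [h4, dotProduct_sub, add_sub_cancel_left (G := Fin n → ℤ), h.dual i i, if_pos rfl] at h3
  rw [dotProduct_sub] at h1
  suffices -1 < N * ∑ l ∈ Finset.univ.erase i, u l ⬝ᵥ (s - x) - u i ⬝ᵥ (s - x) by linarith
  have hnn : 0 ≤ ∑ l ∈ Finset.univ.erase i, u l ⬝ᵥ (s - x) :=
    Finset.sum_nonneg fun l _ => h.int_nonneg l hs
  have hi := h.int_nonneg i hs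
  have hN : u i ⬝ᵥ (s - x) ≤ N :=
    Finset.single_le_sum (f := fun s => u i ⬝ᵥ (s - x)) (fun s hs => h.int_nonneg i hs) hs
  rcases hnn.eq_or_lt with h0 | hpos
  · have hsx' := h.eq_add_smul i hs h0.symm
    have h5 := hle (u i ⬝ᵥ (s - x)) (hsx' ▸ hs)
    have h6 : u i ⬝ᵥ (s - x) ≠ 1 := by
      intro h7
      rw [h7, one_smul] at hsx'
      exact hsx hsx'
    rw [← h0]
    omega
  · nlinarith

/-- A facet `H` at lattice distance one from the point `x`, with inner normal `p`. -/
structure IsOppositeFacet {n : ℕ} (S : Finset (Fin n → ℤ)) (x p : Fin n → ℤ)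
    (H : Set (Fin n → ℝ)) : Prop where
  facet : IsFaceOfDim (latticeHull S) H (n - 1)
  eq : H = {z ∈ latticeHull S | pair p z = pair p (latt x) - 1}
  ge : ∀ z ∈ latticeHull S, pair p (latt x) - 1 ≤ pair p z

theorem IsVertexChart.exists_oppositeFacet {n : ℕ} {S : Finset (Fin n → ℤ)} {x : Fin n → ℤ}
    {G : Fin n → Set (Fin n → ℝ)} {u f : Fin n → Fin n → ℤ} (h : IsVertexChart S x G u f)
    (hsmooth : IsSmoothPolytope (latticeHull S)) (i : Fin n)
    (hface : IsFaceOfDim (latticeHull S) {latt (x + f i)} 0) :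
    ∃ p H, IsOppositeFacet S x p H ∧ p ⬝ᵥ f i = -1 := by
  obtain ⟨G', u', f', h'⟩ := hsmooth.exists_chart hface
  have hex : ∀ l : {l // l ≠ i}, ∃ r, G l = G' r := by
    rintro ⟨l, hl⟩
    refine h'.all _ (h.facet l) ?_
    rw [h.eq l]
    refine ⟨h'.mem, ?_⟩
    rw [latt_add, map_add, h.dual.pair_latt_apply, if_neg hl, add_zero]
  choose σ hσ using hex
  have hσinj : Function.Injective σ := fun a b hab =>
    Subtype.ext (h.inj (by rw [hσ a, hσ b, hab]))
  have hcard : (Finset.univ.image σ).card + 1 = n := by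
    rw [Finset.card_image_of_injective _ hσinj, Finset.card_univ, Fintype.card_subtype_compl]
    have := i.pos
    simp
    omega
  obtain ⟨q, hq⟩ : ∃ q, q ∉ Finset.univ.image σ := by
    by_contra! hcon
    rw [Finset.eq_univ_iff_forall.mpr hcon] at hcard
    simp at hcard
  have hall : ∀ r, r ≠ q → ∃ l, σ l = r := by
    have : insert q (Finset.univ.image σ) = Finset.univ := by
      rw [← Finset.card_eq_iff_eq_univ, Finset.card_insert_of_notMem hq, hcard, Fintype.card_fin]
    intro r hr
    have hr' := Finset.mem_univ r
    rw [← this, Finset.mem_insert] at hr'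
    simpa [hr] using hr'
  have hzero : ∀ r, r ≠ q → u' r ⬝ᵥ f i = 0 := by
    intro r hr
    obtain ⟨l, rfl⟩ := hall r hr
    have hx : latt x ∈ G l := by
      rw [h.eq l]
      exact ⟨h.mem, rfl⟩
    rw [hσ l, h'.eq] at hx
    have h1 := hx.2
    rw [latt_add, map_add, pair_latt _ (f i)] at h1
    have h2 : ((u' (σ l) ⬝ᵥ f i : ℤ) : ℝ) = 0 := by linarith
    exact_mod_cast h2
  have hpf : u' q ⬝ᵥ f i = -1 := by
    have h1 := h'.dual.decomp_int (f i)
    rw [Finset.sum_eq_single q (fun r _ hr => by rw [hzero r hr, zero_smul]) (by simp)] at h1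
    have h2 := h.dual i i
    rw [if_pos rfl, ← h1, dotProduct_smul, smul_eq_mul] at h2
    have h3 := h'.ge q _ h.mem
    rw [latt_add, map_add, pair_latt _ (f i)] at h3
    have h4 : ((u' q ⬝ᵥ f i : ℤ) : ℝ) ≤ 0 := by linarith
    have h5 : u' q ⬝ᵥ f i ≤ 0 := by exact_mod_cast h4
    rcases Int.eq_one_or_neg_one_of_mul_eq_one h2 with h6 | h6 <;> omega
  have hval : pair (u' q) (latt (x + f i)) = pair (u' q) (latt x) - 1 := by
    rw [latt_add, map_add, pair_latt _ (f i), hpf]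
    norm_num
    ring
  exact ⟨u' q, G' q, ⟨h'.facet q, by rw [← hval]; exact h'.eq q, by
    rw [← hval]; exact h'.ge q⟩, hpf⟩

theorem IsOppositeFacet.int_ge {n : ℕ} {S : Finset (Fin n → ℤ)} {x p : Fin n → ℤ}
    {H : Set (Fin n → ℝ)} (hp : IsOppositeFacet S x p H) {s : Fin n → ℤ} (hs : s ∈ S) :
    -1 ≤ p ⬝ᵥ (s - x) := by
  have := hp.ge _ (latt_mem_convexHull hs)
  rw [pair_latt, pair_latt] at this
  have h2 : p ⬝ᵥ x - 1 ≤ p ⬝ᵥ s := by exact_mod_cast this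
  rw [dotProduct_sub]
  omega

theorem IsOppositeFacet.neg_one_le {n : ℕ} {S : Finset (Fin n → ℤ)} {x p : Fin n → ℤ}
    {H : Set (Fin n → ℝ)} (hp : IsOppositeFacet S x p H)
    {G : Fin n → Set (Fin n → ℝ)} {u f : Fin n → Fin n → ℤ} (h : IsVertexChart S x G u f)
    (hfull : affineSpan ℝ (latticeHull S) = ⊤) (l : Fin n) : -1 ≤ p ⬝ᵥ f l := by
  obtain ⟨k, hk, hkS⟩ := h.exists_edge hfull l
  have h1 := hp.int_ge hkS
  rw [add_sub_cancel_left, dotProduct_smul, smul_eq_mul] at h1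
  nlinarith

/-- Crossing the edge from `x` to the facet `H` in a direction `f_j` with `⟨p, f_j⟩ = -1`, one finds
the lattice points adjacent to `x + f_j`. -/
theorem IsOppositeFacet.mem_of_eq_neg_one {n : ℕ} {S : Finset (Fin n → ℤ)} {x p : Fin n → ℤ}
    {H : Set (Fin n → ℝ)} (hp : IsOppositeFacet S x p H)
    {G : Fin n → Set (Fin n → ℝ)} {u f : Fin n → Fin n → ℤ} (h : IsVertexChart S x G u f)
    (hfull : affineSpan ℝ (latticeHull S) = ⊤) (hsmooth : IsSmoothPolytope (latticeHull S))
    {j : Fin n} (hj : p ⬝ᵥ f j = -1) :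
    latt (x + f j) ∈ latticeHull S ∧
      ∀ l, l ≠ j → latt (x + f l + (1 + p ⬝ᵥ f l) • f j) ∈ latticeHull S := by
  have hmem : x + f j ∈ S := by
    obtain ⟨k, hk, hkS⟩ := h.exists_edge hfull j
    have h1 := hp.int_ge hkS
    rw [add_sub_cancel_left, dotProduct_smul, smul_eq_mul, hj] at h1
    rw [show k = 1 by omega, one_smul] at hkS
    exact hkS
  have hface : IsFaceOfDim (latticeHull S) {latt (x + f j)} 0 := by
    refine isFaceOfDim_zero_of_strict_min hmem (pair (∑ l ∈ Finset.univ.erase j, u l + p)) ?_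
    intro s hs hsx
    rw [pair_latt, pair_latt, Int.cast_lt]
    have h1 : (∑ l ∈ Finset.univ.erase j, u l + p) ⬝ᵥ f j = -1 := by
      rw [add_dotProduct, sum_dotProduct, hj, Finset.sum_eq_zero (fun l hl => by
        rw [h.dual l j, if_neg (Finset.ne_of_mem_erase hl)]), zero_add]
    have h2 : (∑ l ∈ Finset.univ.erase j, u l + p) ⬝ᵥ (s - x) =
        ∑ l ∈ Finset.univ.erase j, u l ⬝ᵥ (s - x) + p ⬝ᵥ (s - x) := by
      rw [add_dotProduct, sum_dotProduct]
    rw [dotProduct_sub] at h2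
    rw [dotProduct_add, h1]
    have hnn : 0 ≤ ∑ l ∈ Finset.univ.erase j, u l ⬝ᵥ (s - x) :=
      Finset.sum_nonneg fun l _ => h.int_nonneg l hs
    have h3 := hp.int_ge hs
    by_contra! hcon
    have h4 : ∑ l ∈ Finset.univ.erase j, u l ⬝ᵥ (s - x) = 0 := by omega
    have h5 : p ⬝ᵥ (s - x) = -1 := by omega
    have h6 := h.eq_add_smul j hs h4
    have h7 := h5
    rw [h6, add_sub_cancel_left, dotProduct_smul, hj, smul_eq_mul] at h7
    rw [show u j ⬝ᵥ (s - x) = 1 by omega, one_smul] at h6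
    exact hsx h6
  obtain ⟨G', u', f', h'⟩ := hsmooth.exists_chart hface
  have hval : pair p (latt (x + f j)) = pair p (latt x) - 1 := by
    rw [latt_add, map_add, pair_latt _ (f j), hj]
    norm_num
    ring
  have hxG : ∀ l, latt x ∈ G l := fun l => by rw [h.eq l]; exact ⟨h.mem, rfl⟩
  have hxH : latt x ∉ H := by
    rw [hp.eq]
    intro hx
    linarith [hx.2]
  have hupd : ∀ l, ∃ r, Function.update G j H l = G' r := by
    intro l
    by_cases hl : l = j
    · subst hl
      rw [Function.update_self]
      refine h'.all _ hp.facet ?_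
      rw [hp.eq]
      exact ⟨h'.mem, hval⟩
    · rw [Function.update_of_ne hl]
      refine h'.all _ (h.facet l) ?_
      rw [h.eq l]
      refine ⟨h'.mem, ?_⟩
      rw [latt_add, map_add, h.dual.pair_latt_apply, if_neg hl, add_zero]
  choose τ hτ using hupd
  have hGinj : Function.Injective (Function.update G j H) := by
    intro a b hab
    by_cases ha : a = j <;> by_cases hb : b = j
    · rw [ha, hb]
    · rw [ha, Function.update_self, Function.update_of_ne hb] at hab
      exact absurd (hab ▸ hxG b) hxH
    · rw [hb, Function.update_self, Function.update_of_ne ha] at hab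
      exact absurd (hab ▸ hxG a) hxH
    · rw [Function.update_of_ne ha, Function.update_of_ne hb] at hab
      exact h.inj hab
  have hτsurj : Function.Surjective τ := Finite.surjective_of_injective fun a b hab =>
    hGinj (by rw [hτ a, hτ b, hab])
  refine ⟨h'.mem, fun l hl => ?_⟩
  obtain ⟨k, hk, hkS⟩ := exists_edge_endpoint hfull h'.mem (h.dual.update j p hj) (by
      intro l s hs
      rw [← sub_sub, dotProduct_sub]
      by_cases hl : l = j
      · rw [hl, Function.update_self, hj]
        have := hp.int_ge hs
        omega
      · rw [Function.update_of_ne hl, h.dual l j, if_neg hl, sub_zero]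
        exact h.int_nonneg l hs) (by
      intro F hF hxF
      obtain ⟨r, rfl⟩ := h'.all F hF hxF
      obtain ⟨l, rfl⟩ := hτsurj r
      refine ⟨l, fun z hz => ?_⟩
      rw [← hτ l] at hz
      by_cases hl : l = j
      · subst hl
        rw [Function.update_self, hp.eq] at hz
        rw [Function.update_self, hval]
        exact hz.2
      · rw [Function.update_of_ne hl, h.eq] at hz
        rw [Function.update_of_ne hl, hz.2, latt_add, map_add, h.dual.pair_latt_apply, if_neg hl,
          add_zero]) l
  have h1 := latt_add_smul_mem (convex_convexHull ℝ _) h'.mem (latt_mem_convexHull hkS)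
    zero_le_one hk
  rw [one_smul, if_neg hl] at h1
  convert h1 using 2
  rw [add_smul, one_smul]
  abel

theorem exists_dual_le_of_notMem_interior {n : ℕ} {K : Set (Fin n → ℝ)} (hK : Convex ℝ K)
    (hne : (interior K).Nonempty) {y : Fin n → ℝ} (hy : y ∉ interior K) :
    ∃ g : Module.Dual ℝ (Fin n → ℝ), g ≠ 0 ∧ ∀ z ∈ K, g z ≤ g y := by
  obtain ⟨g, hg⟩ := geometric_hahn_banach_open_point hK.interior isOpen_interior hy
  refine ⟨g.toLinearMap, ?_, ?_⟩
  · intro h0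
    obtain ⟨a, ha⟩ := hne
    have h1 := hg a ha
    have h2 : ∀ z, g z = 0 := fun z => by
      have := LinearMap.congr_fun h0 z
      exact this
    rw [h2, h2] at h1
    exact lt_irrefl _ h1
  · have hcl : closure (interior K) ⊆ {z | g z ≤ g y} := by
      apply closure_minimal
      · intro z hz
        exact (hg z hz).le
      · exact isClosed_le g.continuous continuous_const
    rw [hK.closure_interior_eq_closure_of_nonempty_interior hne] at hcl
    exact fun z hz => hcl (subset_closure hz)

/-- Below the codegree, lattice points of the cone at a vertex which are interior to the cone are
cut off from the dilate by a functional. -/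
theorem IsVertexChart.exists_functional {n : ℕ} {S : Finset (Fin n → ℤ)} {x : Fin n → ℤ}
    {G : Fin n → Set (Fin n → ℝ)} {u f : Fin n → Fin n → ℤ} (h : IsVertexChart S x G u f)
    (hfull : affineSpan ℝ (latticeHull S) = ⊤) {t : ℕ} (ht : 1 ≤ t)
    (htc : t < cd (latticeHull S)) (m : Fin n → ℤ) (hm : ∀ i, 1 ≤ m i) :
    ∃ (g : Module.Dual ℝ (Fin n → ℝ)) (b : ℝ), 0 < b ∧
      (∀ z ∈ latticeHull S, g z - g (latt x) ≤ b) ∧ ∑ i, (m i : ℝ) * g (latt (f i)) = t * b := by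
  have htpos : (0 : ℝ) < t := by exact_mod_cast ht
  have hconv : Convex ℝ (latticeHull S) := convex_convexHull ℝ _
  have hinterior : (interior ((t : ℝ) • latticeHull S)).Nonempty := by
    rw [interior_smul₀ htpos.ne']
    exact (hconv.interior_nonempty_iff_affineSpan_eq_top.mpr hfull).smul_set
  set v : Fin n → ℤ := ∑ i, m i • f i with hv
  have hy : latt ((t : ℤ) • x + v) ∉ interior ((t : ℝ) • latticeHull S) := fun hmem =>
    Nat.notMem_of_lt_sInf htc ⟨ht, _, interior_subset_intrinsicInterior hmem⟩
  obtain ⟨g, hg0, hg⟩ := exists_dual_le_of_notMem_interior (hconv.smul _) hinterior hy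
  have hgv : g (latt v) = ∑ i, (m i : ℝ) * g (latt (f i)) := by
    rw [hv, latt_sum, map_sum]
    simp only [latt_smul, map_smul, smul_eq_mul]
  have hle : ∀ z ∈ latticeHull S, g z - g (latt x) ≤ g (latt v) / t := by
    intro z hz
    have := hg _ (Set.smul_mem_smul_set (a := (t : ℝ)) hz)
    rw [latt_add, latt_smul, map_add, map_smul, map_smul, smul_eq_mul, smul_eq_mul,
      Int.cast_natCast] at this
    rw [le_div_iff₀ htpos]
    linarith
  refine ⟨g, g (latt v) / t, ?_, hle, ?_⟩
  · have h0 := hle _ h.mem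
    rw [sub_self] at h0
    refine lt_of_le_of_ne h0 fun heq => hg0 ?_
    have hneg : ∀ i, g (latt (f i)) ≤ 0 := by
      intro i
      obtain ⟨k, hk, hkS⟩ := h.exists_edge hfull i
      have h1 := hle _ (latt_mem_convexHull hkS)
      rw [← heq, latt_add, latt_smul, map_add, map_smul, add_sub_cancel_left, smul_eq_mul] at h1
      have hk' : (0 : ℝ) < k := by exact_mod_cast hk
      exact nonpos_of_mul_nonpos_right h1 hk'
    have hmpos : ∀ i, (0 : ℝ) < m i := fun i => by exact_mod_cast hm i
    have hv0 : ∑ i, (m i : ℝ) * g (latt (f i)) = 0 := by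
      rw [← hgv]
      have := heq.symm
      rw [div_eq_zero_iff] at this
      exact this.resolve_right htpos.ne'
    rw [Finset.sum_eq_zero_iff_of_nonpos
      fun i _ => mul_nonpos_of_nonneg_of_nonpos (hmpos i).le (hneg i)] at hv0
    refine LinearMap.ext fun z => ?_
    rw [← h.dual.decomp z, map_sum]
    refine Finset.sum_eq_zero fun i hi => ?_
    rw [map_smul, (mul_eq_zero.mp (hv0 i hi)).resolve_left (hmpos i).ne', smul_zero]
  · rw [← hgv]
    field_simp

theorem IsVertexChart.latt_add_mem {n : ℕ} {S : Finset (Fin n → ℤ)} {x : Fin n → ℤ}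
    {G : Fin n → Set (Fin n → ℝ)} {u f : Fin n → Fin n → ℤ} (h : IsVertexChart S x G u f)
    (hfull : affineSpan ℝ (latticeHull S) = ⊤) (i : Fin n) :
    latt (x + f i) ∈ latticeHull S := by
  obtain ⟨k, hk, hkS⟩ := h.exists_edge hfull i
  have := latt_add_smul_mem (convex_convexHull ℝ _) h.mem (latt_mem_convexHull hkS) zero_le_one hk
  rwa [one_smul] at this

theorem IsOppositeFacet.latt_add_add_mem {n : ℕ} {S : Finset (Fin n → ℤ)} {x p : Fin n → ℤ}
    {H : Set (Fin n → ℝ)} (hp : IsOppositeFacet S x p H)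
    {G : Fin n → Set (Fin n → ℝ)} {u f : Fin n → Fin n → ℤ} (h : IsVertexChart S x G u f)
    (hfull : affineSpan ℝ (latticeHull S) = ⊤) (hsmooth : IsSmoothPolytope (latticeHull S))
    {j l : Fin n} (hj : p ⬝ᵥ f j = -1) (hl : l ≠ j) {m : ℤ} (hm : 0 ≤ m)
    (hml : m ≤ 1 + p ⬝ᵥ f l) : latt (x + f l + m • f j) ∈ latticeHull S :=
  latt_add_smul_mem (convex_convexHull ℝ _) (h.latt_add_mem hfull l)
    ((hp.mem_of_eq_neg_one h hfull hsmooth hj).2 l hl) hm hml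

/-- A small dilate without interior lattice points forces a facet at distance one that is met by at
least `t` of the edges at the vertex. -/
theorem IsVertexChart.exists_oppositeFacet_card {n : ℕ} {S : Finset (Fin n → ℤ)} {x : Fin n → ℤ}
    {G : Fin n → Set (Fin n → ℝ)} {u f : Fin n → Fin n → ℤ} (h : IsVertexChart S x G u f)
    (hfull : affineSpan ℝ (latticeHull S) = ⊤) (hsmooth : IsSmoothPolytope (latticeHull S))
    {t : ℕ} (htc : t < cd (latticeHull S)) (hnt : n + 1 ≤ 2 * t) :
    ∃ p H, IsOppositeFacet S x p H ∧ t ≤ (Finset.univ.filter fun j => p ⬝ᵥ f j = -1).card := by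
  obtain ⟨g, b, hb, hg, hsum⟩ := h.exists_functional hfull (by omega) htc 1 (fun _ => le_rfl)
  simp only [Pi.one_apply, Int.cast_one, one_mul] at hsum
  have htpos : (0 : ℝ) < t := by exact_mod_cast (by omega : 0 < t)
  have hnt' : (n : ℝ) + 1 ≤ 2 * t := by exact_mod_cast hnt
  have hne : (Finset.univ : Finset (Fin n)).Nonempty := by
    by_contra hcon
    rw [Finset.not_nonempty_iff_eq_empty] at hcon
    rw [hcon, Finset.sum_empty] at hsum
    nlinarith
  obtain ⟨i, -, hmax⟩ := Finset.exists_max_image Finset.univ (fun i => g (latt (f i))) hne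
  set a := g (latt (f i)) with ha
  have hna : t * b ≤ n * a := by
    rw [← hsum]
    have := Finset.sum_le_card_nsmul Finset.univ (fun i => g (latt (f i))) a hmax
    simpa using this
  have hab : b < 2 * a := by
    by_contra! hcon
    nlinarith [Nat.cast_nonneg (α := ℝ) n]
  have h2 : latt (x + (2 : ℤ) • f i) ∉ latticeHull S := by
    intro hmem
    have := hg _ hmem
    rw [latt_add, latt_smul, map_add, map_smul, smul_eq_mul, ← ha] at this
    push_cast at this
    linarith
  obtain ⟨hiS, hface⟩ := h.isFaceOfDim_edge hfull i h2
  obtain ⟨p, H, hp, hpi⟩ := h.exists_oppositeFacet hsmooth i hface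
  refine ⟨p, H, hp, ?_⟩
  set C := Finset.univ.filter fun j => p ⬝ᵥ f j = -1 with hC
  have hale : a ≤ b := by
    have := hg _ (latt_mem_convexHull hiS)
    rw [latt_add, map_add] at this
    linarith
  have hout : ∀ l ∈ Cᶜ, g (latt (f l)) ≤ b - a := by
    intro l hl
    have hl' : p ⬝ᵥ f l ≠ -1 := by simpa [hC] using hl
    have hpl := hp.neg_one_le h hfull l
    have hli : l ≠ i := by rintro rfl; exact hl' hpi
    have := hg _ (hp.latt_add_add_mem h hfull hsmooth hpi hli zero_le_one (by omega))
    rw [one_smul, latt_add, latt_add, map_add, map_add] at this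
    linarith
  by_contra! hcard
  have h3 := Finset.sum_le_card_nsmul C (fun i => g (latt (f i))) a fun l _ =>
    hmax l (Finset.mem_univ l)
  have h4 := Finset.sum_le_card_nsmul Cᶜ (fun i => g (latt (f i))) (b - a) hout
  have h5 : (C.card : ℝ) + Cᶜ.card = n := by
    exact_mod_cast (Finset.card_add_card_compl C).trans (Fintype.card_fin n)
  have h6 : (C.card : ℝ) + 1 ≤ t := by exact_mod_cast hcard
  rw [← Finset.sum_add_sum_compl C] at hsum
  rw [nsmul_eq_mul] at h3 h4
  have h7 : (Cᶜ.card : ℝ) = n - C.card := by linarith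
  rw [h7] at h4
  have h8 : ((n : ℝ) - C.card) * (b - a) ≤ (2 * t - 1 - C.card) * (b - a) :=
    mul_le_mul_of_nonneg_right (by linarith) (by linarith)
  have h9 : (C.card : ℝ) * (2 * a - b) ≤ (t - 1) * (2 * a - b) :=
    mul_le_mul_of_nonneg_right (by linarith) (by linarith)
  nlinarith

theorem IsOppositeFacet.nonpos {n : ℕ} {S : Finset (Fin n → ℤ)} {x p : Fin n → ℤ}
    {H : Set (Fin n → ℝ)} (hp : IsOppositeFacet S x p H)
    {G : Fin n → Set (Fin n → ℝ)} {u f : Fin n → Fin n → ℤ} (h : IsVertexChart S x G u f)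
    (hfull : affineSpan ℝ (latticeHull S) = ⊤) (hsmooth : IsSmoothPolytope (latticeHull S))
    {t : ℕ} (htc : t < cd (latticeHull S)) (hnt : n + 1 ≤ 2 * t)
    (hcard : t ≤ (Finset.univ.filter fun j => p ⬝ᵥ f j = -1).card) (r : Fin n) :
    p ⬝ᵥ f r ≤ 0 := by
  by_contra! hr
  set C := Finset.univ.filter fun j => p ⬝ᵥ f j = -1 with hC
  have hCr : r ∈ Cᶜ := by simp [hC]; omega
  obtain ⟨M, hM1, hM⟩ : ∃ M : ℕ, 1 ≤ M ∧
      (2 * M + n = 2 * C.card + 1 ∨ 2 * M + n = 2 * C.card) :=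
    ⟨(2 * C.card + 1 - n) / 2, by omega, by omega⟩
  obtain ⟨g, b, hb, hg, hsum⟩ := h.exists_functional hfull (by omega) htc
    (fun l => if l = r then (M : ℤ) else 1) (fun l => by split_ifs <;> omega)
  have hne : C.Nonempty := Finset.card_pos.mp (by omega)
  obtain ⟨j, hjC, hmax⟩ := Finset.exists_max_image C (fun i => g (latt (f i))) hne
  have hj : p ⬝ᵥ f j = -1 := by simpa [hC] using hjC
  set a := g (latt (f j)) with ha
  have hale : a ≤ b := by
    have := hg _ (h.latt_add_mem hfull j)
    rw [latt_add, map_add] at this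
    linarith
  have hout : ∀ l ∈ Cᶜ.erase r, (((if l = r then (M : ℤ) else 1 : ℤ)) : ℝ) * g (latt (f l)) ≤
      b - a := by
    intro l hl
    rw [if_neg (Finset.ne_of_mem_erase hl), Int.cast_one, one_mul]
    have hl' : p ⬝ᵥ f l ≠ -1 := by simpa [hC] using Finset.mem_of_mem_erase hl
    have hpl := hp.neg_one_le h hfull l
    have hlj : l ≠ j := by rintro rfl; exact hl' hj
    have := hg _ (hp.latt_add_add_mem h hfull hsmooth hj hlj zero_le_one (by omega))
    rw [one_smul, latt_add, latt_add, map_add, map_add] at this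
    linarith
  have hin : ∀ l ∈ C, (((if l = r then (M : ℤ) else 1 : ℤ)) : ℝ) * g (latt (f l)) ≤ a := by
    intro l hl
    rw [if_neg, Int.cast_one, one_mul]
    · exact hmax l hl
    · rintro rfl
      exact Finset.mem_compl.mp hCr hl
  have hrj : r ≠ j := by rintro rfl; omega
  have hr2 : g (latt (f r)) ≤ b - 2 * a := by
    have := hg _ (hp.latt_add_add_mem h hfull hsmooth hj hrj zero_le_two (by omega))
    rw [latt_add, latt_add, latt_smul, map_add, map_add, map_smul, smul_eq_mul] at this
    push_cast at this
    linarith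
  have h3 := Finset.sum_le_card_nsmul _ _ _ hin
  have h4 := Finset.sum_le_card_nsmul _ _ _ hout
  have h5 : (C.card : ℝ) + Cᶜ.card = n := by
    exact_mod_cast (Finset.card_add_card_compl C).trans (Fintype.card_fin n)
  have h6 : ((Cᶜ.erase r).card : ℝ) + 1 = Cᶜ.card := by
    exact_mod_cast Finset.card_erase_add_one hCr
  rw [← Finset.sum_add_sum_compl C, ← Finset.add_sum_erase _ _ hCr, if_pos rfl,
    Int.cast_natCast] at hsum
  rw [nsmul_eq_mul] at h3 h4
  have h7 : (M : ℝ) * g (latt (f r)) ≤ M * (b - 2 * a) :=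
    mul_le_mul_of_nonneg_left hr2 (Nat.cast_nonneg M)
  have h8 : ((Cᶜ.erase r).card : ℝ) = n - C.card - 1 := by linarith
  rw [h8] at h4
  have hnt' : (n : ℝ) + 1 ≤ 2 * t := by exact_mod_cast hnt
  rcases hM with hM | hM
  · have hM' : (M : ℝ) = C.card + 1 / 2 - n / 2 := by
      have : 2 * (M : ℝ) + n = 2 * C.card + 1 := by exact_mod_cast hM
      linarith
    rw [hM'] at h7 hsum
    nlinarith
  · have hM' : (M : ℝ) = C.card - n / 2 := by
      have : 2 * (M : ℝ) + n = 2 * C.card := by exact_mod_cast hM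
      linarith
    rw [hM'] at h7 hsum
    nlinarith

theorem IsVertexChart.exists_cayley_directions {n : ℕ} {S : Finset (Fin n → ℤ)} {x : Fin n → ℤ}
    {G : Fin n → Set (Fin n → ℝ)} {u f : Fin n → Fin n → ℤ} (h : IsVertexChart S x G u f)
    (hfull : affineSpan ℝ (latticeHull S) = ⊤) (hsmooth : IsSmoothPolytope (latticeHull S))
    {t : ℕ} (htc : t < cd (latticeHull S)) (hnt : n + 1 ≤ 2 * t) :
    ∃ C : Finset (Fin n), C.card = t ∧ ∀ s ∈ S, ∑ j ∈ C, u j ⬝ᵥ (s - x) ≤ 1 := by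
  obtain ⟨p, H, hp, hcard⟩ := h.exists_oppositeFacet_card hfull hsmooth htc hnt
  obtain ⟨C, hCsub, hC⟩ := Finset.exists_subset_card_eq hcard
  refine ⟨C, hC, fun s hs => ?_⟩
  refine (Finset.sum_le_sum_of_subset_of_nonneg hCsub fun j _ _ => h.int_nonneg j hs).trans ?_
  have h1 := hp.int_ge hs
  rw [← h.dual.decomp_int (s - x), dotProduct_sum] at h1
  rw [Finset.sum_filter]
  have h2 : ∑ l, p ⬝ᵥ ((u l ⬝ᵥ (s - x)) • f l) =
      -∑ l, if p ⬝ᵥ f l = -1 then u l ⬝ᵥ (s - x) else 0 := by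
    rw [← Finset.sum_neg_distrib]
    refine Finset.sum_congr rfl fun l _ => ?_
    have h3 := hp.nonpos h hfull hsmooth htc hnt hcard l
    have h4 := hp.neg_one_le h hfull l
    rw [dotProduct_smul, smul_eq_mul]
    split_ifs with h5
    · rw [h5]; ring
    · rw [show p ⬝ᵥ f l = 0 by omega]; ring
  omega

theorem cayleyVertex_combo {d c : ℕ} (i : Fin c) {p q : Fin d → ℝ} {α β : ℝ} (hαβ : α + β = 1) :
    cayleyVertex i (α • p + β • q) = α • cayleyVertex i p + β • cayleyVertex i q := by
  ext m
  refine Fin.addCases (fun m => ?_) (fun m => ?_) m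
  · simp [cayleyVertex]
  · simp only [cayleyVertex, Fin.append_right, Pi.add_apply, Pi.smul_apply, smul_eq_mul]
    split_ifs
    · linarith
    · simp

/-- The affine map sending `(y, w)` to `x + ∑ y_j g_j + ∑ w_k o_k`. -/
def cayleyMap {n d c : ℕ} (x : Fin n → ℤ) (g : Fin d → Fin n → ℤ) (o : Fin c → Fin n → ℤ) :
    (Fin (d + c) → ℝ) →ᵃ[ℝ] (Fin n → ℝ) :=
  (∑ j, (LinearMap.proj (R := ℝ) (φ := fun _ => ℝ) (Fin.castAdd c j)).smulRight (latt (g j)) +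
    ∑ k, (LinearMap.proj (R := ℝ) (φ := fun _ => ℝ) (Fin.natAdd d k)).smulRight
      (latt (o k))).toAffineMap + AffineMap.const ℝ _ (latt x)

theorem cayleyMap_apply {n d c : ℕ} (x : Fin n → ℤ) (g : Fin d → Fin n → ℤ)
    (o : Fin c → Fin n → ℤ) (y : Fin (d + c) → ℝ) :
    cayleyMap x g o y = ∑ j, y (Fin.castAdd c j) • latt (g j) +
      ∑ k, y (Fin.natAdd d k) • latt (o k) + latt x := by
  simp [cayleyMap]

theorem cayleyMap_latt {n d c : ℕ} (x : Fin n → ℤ) (g : Fin d → Fin n → ℤ)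
    (o : Fin c → Fin n → ℤ) (y : Fin (d + c) → ℤ) :
    cayleyMap x g o (latt y) = latt (∑ j, y (Fin.castAdd c j) • g j +
      ∑ k, y (Fin.natAdd d k) • o k + x) := by
  simp only [cayleyMap_apply, latt_add, latt_sum, latt_smul]
  rfl

theorem cayleyMap_cayleyVertex {n d c : ℕ} (x : Fin n → ℤ) (g : Fin d → Fin n → ℤ)
    (o : Fin c → Fin n → ℤ) (i : Fin c) (p : Fin d → ℤ) :
    cayleyMap x g o (cayleyVertex i (latt p)) = latt (∑ j, p j • g j + o i + x) := by
  simp only [cayleyMap_apply, latt_add, latt_sum, latt_smul, cayleyVertex, Fin.append_left,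
    Fin.append_right, ite_smul, one_smul, zero_smul, Finset.sum_ite_eq', Finset.mem_univ, if_true]
  rfl

theorem sum_eq_one_of_mem_affineSpan {d c : ℕ} {Ps : Fin c → Set (Fin d → ℝ)}
    {y : Fin (d + c) → ℝ} (hy : y ∈ affineSpan ℝ (CayleyPolytope Ps)) :
    ∑ k, y (Fin.natAdd d k) = 1 := by
  rw [CayleyPolytope, affineSpan_convexHull] at hy
  set ψ : (Fin (d + c) → ℝ) →ₗ[ℝ] ℝ :=
    ∑ k : Fin c, LinearMap.proj (R := ℝ) (φ := fun _ => ℝ) (Fin.natAdd d k) with hψ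
  have hψa : ∀ y, ψ y = ∑ k, y (Fin.natAdd d k) := fun y => by simp [hψ]
  have h1 : ψ.toAffineMap y ∈ (affineSpan ℝ (⋃ i, cayleyVertex i '' Ps i)).map ψ.toAffineMap :=
    AffineSubspace.mem_map_of_mem _ hy
  rw [AffineSubspace.map_span] at h1
  have h2 : ψ.toAffineMap '' (⋃ i, cayleyVertex i '' Ps i) ⊆ {1} := by
    rintro _ ⟨z, hz, rfl⟩
    obtain ⟨i, p, -, rfl⟩ := Set.mem_iUnion.mp hz
    simp [hψa, cayleyVertex]
  have h3 := affineSpan_mono ℝ h2 h1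
  rw [AffineSubspace.mem_affineSpan_singleton] at h3
  rw [← hψa]
  exact h3

theorem affineSpan_iUnion_eq_top {d c : ℕ} {Ps : Fin c → Set (Fin d → ℝ)}
    (h : ∀ p : Fin d → ℝ, ∃ y ∈ affineSpan ℝ (CayleyPolytope Ps),
      ∀ j, y (Fin.castAdd c j) = p j) : affineSpan ℝ (⋃ i, Ps i) = ⊤ := by
  rw [eq_top_iff]
  intro p _
  obtain ⟨y, hy, hyp⟩ := h p
  rw [CayleyPolytope, affineSpan_convexHull] at hy
  set π : (Fin (d + c) → ℝ) →ₗ[ℝ] (Fin d → ℝ) := LinearMap.funLeft ℝ ℝ (Fin.castAdd c)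
  have h1 : π.toAffineMap y ∈ (affineSpan ℝ (⋃ i, cayleyVertex i '' Ps i)).map π.toAffineMap :=
    AffineSubspace.mem_map_of_mem _ hy
  rw [AffineSubspace.map_span] at h1
  have h2 : π.toAffineMap '' (⋃ i, cayleyVertex i '' Ps i) ⊆ ⋃ i, Ps i := by
    rintro _ ⟨z, hz, rfl⟩
    obtain ⟨i, q, hq, rfl⟩ := Set.mem_iUnion.mp hz
    refine Set.mem_iUnion.mpr ⟨i, ?_⟩
    convert hq using 1
    ext j
    simp [π, cayleyVertex, LinearMap.funLeft_apply]
  have h3 := affineSpan_mono ℝ h2 h1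
  convert h3 using 1
  ext j
  exact (hyp j).symm

/-- If finitely many lattice points have nonnegative coordinates with respect to a lattice basis
at `x`, and the last `t` coordinates have sum at most one, then their convex hull is a Cayley
polytope. -/
theorem exists_cayley_of_sum_le_one {n d t : ℕ} {S : Finset (Fin n → ℤ)}
    (hfull : affineSpan ℝ (latticeHull S) = ⊤) {x : Fin n → ℤ} {u f : Fin n → Fin n → ℤ}
    (hd : IsDualPair u f) (hnn : ∀ l, ∀ s ∈ S, 0 ≤ u l ⬝ᵥ (s - x)) (e : Fin d ⊕ Fin t ≃ Fin n)
    (hsum : ∀ s ∈ S, ∑ k, u (e (Sum.inr k)) ⬝ᵥ (s - x) ≤ 1) :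
    ∃ Ps : Fin (t + 1) → Set (Fin d → ℝ),
      (∀ i, IsLatticePolytope (Ps i)) ∧
      affineSpan ℝ (⋃ i, Ps i) = (⊤ : AffineSubspace ℝ (Fin d → ℝ)) ∧
      ∃ T : (Fin (d + (t + 1)) → ℝ) →ᵃ[ℝ] (Fin n → ℝ),
        LatticeEquivOnto (CayleyPolytope Ps) (latticeHull S) T := by
  set g : Fin d → Fin n → ℤ := fun j => f (e (Sum.inl j)) with hg
  set o : Fin (t + 1) → Fin n → ℤ := Fin.cons 0 (fun k => f (e (Sum.inr k))) with ho
  set π : (Fin n → ℤ) → Fin d → ℤ := fun s j => u (e (Sum.inl j)) ⬝ᵥ (s - x) with hπ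
  set V : Fin (t + 1) → Finset (Fin d → ℤ) := fun i =>
    (S.filter fun s => ∑ j, π s j • g j + o i + x = s).image π with hV
  set Ps : Fin (t + 1) → Set (Fin d → ℝ) := fun i =>
    convexHull ℝ (latt '' (V i : Set (Fin d → ℤ))) with hPs
  set T := cayleyMap x g o with hT
  have hcoord₁ : ∀ y j, pair (u (e (Sum.inl j))) (T y) =
      y (Fin.castAdd (t + 1) j) + pair (u (e (Sum.inl j))) (latt x) := by
    intro y j
    rw [hT, cayleyMap_apply, map_add, map_add, map_sum, map_sum]
    simp [Fin.sum_univ_succ, ho, hg, hd.pair_latt_apply, show latt (0 : Fin n → ℤ) = 0 from by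
      ext; simp [latt]]
  have hcoord₂ : ∀ y k, pair (u (e (Sum.inr k))) (T y) =
      y (Fin.natAdd d k.succ) + pair (u (e (Sum.inr k))) (latt x) := by
    intro y k
    rw [hT, cayleyMap_apply, map_add, map_add, map_sum, map_sum]
    simp [Fin.sum_univ_succ, ho, hg, hd.pair_latt_apply, show latt (0 : Fin n → ℤ) = 0 from by
      ext; simp [latt]]
  have himage : T '' CayleyPolytope Ps = latticeHull S := by
    apply Set.Subset.antisymm
    · rw [CayleyPolytope, AffineMap.image_convexHull]
      apply convexHull_min _ (convex_convexHull ℝ _)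
      rintro _ ⟨_, hz, rfl⟩
      obtain ⟨i, p, hp, rfl⟩ := Set.mem_iUnion.mp hz
      have hsub : Ps i ⊆ {p | T (cayleyVertex i p) ∈ latticeHull S} := by
        apply convexHull_min
        · rintro _ ⟨q, hq, rfl⟩
          obtain ⟨s, hs, rfl⟩ := Finset.mem_image.mp hq
          rw [Finset.mem_filter] at hs
          change T _ ∈ latticeHull S
          rw [hT, cayleyMap_cayleyVertex, hs.2]
          exact latt_mem_convexHull hs.1
        · intro p hp q hq α β hα hβ hαβ
          change T _ ∈ latticeHull S
          rw [cayleyVertex_combo i hαβ, Convex.combo_affine_apply hαβ]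
          exact convex_convexHull ℝ _ hp hq hα hβ hαβ
      exact hsub hp
    · apply convexHull_min
      · rintro _ ⟨s, hs, rfl⟩
        have hdec := hd.decomp_int (s - x)
        rw [← e.sum_comp, Fintype.sum_sum_type] at hdec
        obtain ⟨i, hi⟩ : ∃ i, ∑ j, π s j • g j + o i + x = s := by
          have h1 := hsum s hs
          by_cases hzero : ∀ k, u (e (Sum.inr k)) ⬝ᵥ (s - x) = 0
          · refine ⟨0, ?_⟩
            simp only [hzero, zero_smul, Finset.sum_const_zero] at hdec
            rw [ho, Fin.cons_zero, hdec, sub_add_cancel]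
          · push Not at hzero
            obtain ⟨k, hk⟩ := hzero
            have hk0 := hnn (e (Sum.inr k)) s hs
            have hrest : 0 ≤ ∑ l ∈ Finset.univ.erase k, u (e (Sum.inr l)) ⬝ᵥ (s - x) :=
              Finset.sum_nonneg fun l _ => hnn _ s hs
            rw [← Finset.add_sum_erase _ _ (Finset.mem_univ k)] at h1
            have hk1 : u (e (Sum.inr k)) ⬝ᵥ (s - x) = 1 := by omega
            have hrest0 : ∑ l ∈ Finset.univ.erase k, u (e (Sum.inr l)) ⬝ᵥ (s - x) = 0 := by omega
            rw [Finset.sum_eq_zero_iff_of_nonneg fun l _ => hnn _ s hs] at hrest0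
            have hrest1 : ∑ l ∈ Finset.univ.erase k,
                (u (e (Sum.inr l)) ⬝ᵥ (s - x)) • f (e (Sum.inr l)) = 0 :=
              Finset.sum_eq_zero fun l hl => by rw [hrest0 l hl, zero_smul]
            refine ⟨k.succ, ?_⟩
            rw [← Finset.add_sum_erase _ (fun k => (u (e (Sum.inr k)) ⬝ᵥ (s - x)) • _)
              (Finset.mem_univ k), hk1, one_smul, hrest1, add_zero] at hdec
            rw [ho, Fin.cons_succ, hdec, sub_add_cancel]
        refine ⟨cayleyVertex i (latt (π s)), subset_convexHull ℝ _ (Set.mem_iUnion.mpr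
          ⟨i, _, subset_convexHull ℝ _ ⟨π s, ?_, rfl⟩, rfl⟩), ?_⟩
        · exact Finset.mem_image_of_mem _ (Finset.mem_filter.mpr ⟨hs, hi⟩)
        · rw [hT, cayleyMap_cayleyVertex, hi]
      · exact (convex_convexHull ℝ _).affine_image T
  have hsurj : T '' (affineSpan ℝ (CayleyPolytope Ps) : Set (Fin (d + (t + 1)) → ℝ)) =
      Set.univ := by
    rw [← AffineSubspace.coe_map, AffineSubspace.map_span, himage, hfull, AffineSubspace.top_coe]
  refine ⟨Ps, fun i => ⟨V i, rfl⟩, affineSpan_iUnion_eq_top fun p => ?_, T, himage, ?_, hsurj, ?_⟩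
  · obtain ⟨y, hy, hTy⟩ : T (Fin.append p 0) ∈
        T '' (affineSpan ℝ (CayleyPolytope Ps) : Set (Fin (d + (t + 1)) → ℝ)) := by
      rw [hsurj]; trivial
    refine ⟨y, hy, fun j => ?_⟩
    have h1 := hcoord₁ y j
    rw [hTy, hcoord₁, Fin.append_left] at h1
    linarith
  · intro y hy z hz hyz
    have h1 : ∀ j, y (Fin.castAdd (t + 1) j) = z (Fin.castAdd (t + 1) j) := fun j => by
      have := hcoord₁ y j
      rw [hyz, hcoord₁] at this
      linarith
    have h2 : ∀ k : Fin t, y (Fin.natAdd d k.succ) = z (Fin.natAdd d k.succ) := fun k => by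
      have := hcoord₂ y k
      rw [hyz, hcoord₂] at this
      linarith
    have h3 := sum_eq_one_of_mem_affineSpan hy
    have h4 := sum_eq_one_of_mem_affineSpan hz
    rw [Fin.sum_univ_succ] at h3 h4
    simp only [h2] at h3
    ext m
    refine Fin.addCases h1 (fun k => ?_) m
    refine Fin.cases ?_ h2 k
    linarith
  · intro y hy
    constructor
    · rintro ⟨z, rfl⟩
      exact ⟨_, cayleyMap_latt x g o z⟩
    · rintro ⟨w, hw⟩
      have h1 : ∀ j, y (Fin.castAdd (t + 1) j) = ((u (e (Sum.inl j)) ⬝ᵥ (w - x) : ℤ) : ℝ) :=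
        fun j => by
          have := hcoord₁ y j
          rw [hw, pair_latt, pair_latt] at this
          rw [dotProduct_sub, Int.cast_sub]
          linarith
      have h2 : ∀ k : Fin t, y (Fin.natAdd d k.succ) =
          ((u (e (Sum.inr k)) ⬝ᵥ (w - x) : ℤ) : ℝ) := fun k => by
        have := hcoord₂ y k
        rw [hw, pair_latt, pair_latt] at this
        rw [dotProduct_sub, Int.cast_sub]
        linarith
      have h3 := sum_eq_one_of_mem_affineSpan hy
      rw [Fin.sum_univ_succ] at h3
      simp only [h2] at h3
      refine ⟨Fin.append (fun j => u (e (Sum.inl j)) ⬝ᵥ (w - x))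
        (Fin.cons (1 - ∑ k, u (e (Sum.inr k)) ⬝ᵥ (w - x))
          fun k => u (e (Sum.inr k)) ⬝ᵥ (w - x)), ?_⟩
      ext m
      refine Fin.addCases (fun j => ?_) (fun k => ?_) m
      · rw [h1, latt, Fin.append_left]
      · refine Fin.cases ?_ (fun k => ?_) k
        · rw [latt, Fin.append_right, Fin.cons_zero]
          push_cast
          linarith
        · rw [h2, latt, Fin.append_right, Fin.cons_succ]

/-- Let `P ⊂ ℝ^n` be an `n`-dimensional smooth lattice polytope of degree
`d = n + 1 - cd(P)` with `cd(P) ≥ (n+3)/2`.  Then `P` is affinely isomorphic, by a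
lattice-point preserving affine isomorphism, to a Cayley polytope of `cd P` lattice
polytopes (so `k = cd P - 1`) in `ℝ^m` with `m = deg P = d`. -/
theorem smooth_high_codegree_is_cayley {n d : ℕ} (P : Set (Fin n → ℝ))
    (hP : IsLatticePolytope P) (hfull : affineSpan ℝ P = ⊤)
    (hsmooth : IsSmoothPolytope P)
    (hdeg : d + cd P = n + 1)
    (hcd : n + 3 ≤ 2 * cd P) :
    ∃ Ps : Fin (cd P) → Set (Fin d → ℝ),
      (∀ i, IsLatticePolytope (Ps i)) ∧
      affineSpan ℝ (⋃ i, Ps i) = (⊤ : AffineSubspace ℝ (Fin d → ℝ)) ∧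
      ∃ T : (Fin (d + cd P) → ℝ) →ᵃ[ℝ] (Fin n → ℝ),
        LatticeEquivOnto (CayleyPolytope Ps) P T := by
  obtain ⟨S, rfl⟩ := hP
  have hS : S.Nonempty := by
    rw [Finset.nonempty_iff_ne_empty]
    rintro rfl
    simp at hfull
  obtain ⟨x, -, hx⟩ := exists_vertex hS
  obtain ⟨G, u, f, h⟩ := hsmooth.exists_chart hx
  obtain ⟨t, ht⟩ : ∃ t, cd (convexHull ℝ (latt '' (S : Set (Fin n → ℤ)))) = t + 1 :=
    ⟨_, (Nat.sub_add_cancel (by omega)).symm⟩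
  obtain ⟨C, hC, hsum⟩ := h.exists_cayley_directions hfull hsmooth
    ((Nat.lt_succ_self t).trans_eq ht.symm) (by omega)
  have hD : Cᶜ.card = d := by
    rw [Finset.card_compl, hC, Fintype.card_fin]
    omega
  have hC' : Cᶜᶜ.card = t := by rw [compl_compl, hC]
  rw [ht]
  refine exists_cayley_of_sum_le_one hfull h.dual (fun l s hs => h.int_nonneg l hs)
    (finSumEquivOfFinset hD hC') fun s hs => ?_
  convert hsum s hs using 1
  conv_rhs => rw [← compl_compl C, ← Finset.map_orderEmbOfFin_univ Cᶜᶜ hC', Finset.sum_map]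
  rfl
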